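/- arXiv:2012.06220 — 2 statements merged into one kernel-verified Lean document; each statement's English description precedes it below -/
import Mathlib

section
/- There exists a constant C > 0 such that for all u > e², |g(u) log u - 1| ≤ C u^{-(1/2) log(π/2)}, where g(u) = ∑_{n=1}^∞ (1/n) χ^{*n}(u) and χ is the indicator of [e, e²]. -/
open Real

/-- Multiplicative convolution `(f*h)(x) = ∫₁^x f(x/u) h(u) du/u`. -/
noncomputable def mconv (f h : ℝ → ℝ) : ℝ → ℝ := fun x => ∫ u in (1:ℝ)..x, f (x / u) * h u / u

/-- `χ`, the indicator function of `[e, e²]`. -/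
noncomputable def chi : ℝ → ℝ := Set.indicator (Set.Icc (Real.exp 1) (Real.exp 2)) 1

/-- `chiPow n = χ^{*(n+1)}`. -/
noncomputable def chiPow : ℕ → (ℝ → ℝ)
  | 0 => chi
  | n + 1 => mconv (chiPow n) chi

/-- `g(u) = ∑_{n≥1} χ^{*n}(u)/n`. -/
noncomputable def g (u : ℝ) : ℝ := ∑' n : ℕ, chiPow n u / (n + 1)

section LocallyBounded

/-- Boundedness on bounded sets of reals. -/
def LocBounded (f : ℝ → ℝ) : Prop := ∀ R, ∃ B, ∀ x, |x| ≤ R → |f x| ≤ B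

theorem LocBounded.intervalIntegrable {f : ℝ → ℝ} (hb : LocBounded f) (hm : Measurable f)
    (a b : ℝ) : IntervalIntegrable f MeasureTheory.volume a b := by
  obtain ⟨B, hB⟩ := hb (max |a| |b|)
  rw [intervalIntegrable_iff]
  refine MeasureTheory.IntegrableOn.of_bound (by simp [Set.uIoc]) hm.aestronglyMeasurable B ?_
  refine (MeasureTheory.ae_restrict_iff' measurableSet_uIoc).2 (.of_forall fun x hx => hB x ?_)
  rcases Set.mem_uIoc.1 hx with h | h
  · exact abs_le_max_abs_abs h.1.le h.2
  · rw [max_comm]; exact abs_le_max_abs_abs h.1.le h.2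

theorem LocBounded.comp_sub {f : ℝ → ℝ} (hb : LocBounded f) (t : ℝ) :
    LocBounded fun s => f (t - s) := by
  intro R
  obtain ⟨B, hB⟩ := hb (|t| + R)
  exact ⟨B, fun x hx => hB _ ((abs_sub _ _).trans (by linarith))⟩

theorem LocBounded.mul {f k : ℝ → ℝ} (hf : LocBounded f) (hk : LocBounded k) :
    LocBounded fun s => f s * k s := by
  intro R
  obtain ⟨B, hB⟩ := hf R
  obtain ⟨B', hB'⟩ := hk R
  refine ⟨B * B', fun x hx => ?_⟩
  rw [abs_mul]
  exact mul_le_mul (hB x hx) (hB' x hx) (abs_nonneg _) ((abs_nonneg _).trans (hB x hx))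

theorem locBounded_id : LocBounded fun x => x := fun R => ⟨R, fun _ h => h⟩

theorem intervalIntegral_swap_of_bounded {F : ℝ → ℝ → ℝ} (hF : Measurable (Function.uncurry F))
    {a b c d : ℝ} (hab : a ≤ b) (hcd : c ≤ d) {B : ℝ}
    (hB : ∀ x ∈ Set.Icc a b, ∀ y ∈ Set.Icc c d, |F x y| ≤ B) :
    ∫ x in a..b, ∫ y in c..d, F x y = ∫ y in c..d, ∫ x in a..b, F x y := by
  apply MeasureTheory.intervalIntegral_intervalIntegral_swap
  rw [Set.uIoc_of_le hab, Set.uIoc_of_le hcd]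
  refine MeasureTheory.IntegrableOn.of_bound ?_ hF.aestronglyMeasurable B ?_
  · rw [MeasureTheory.Measure.volume_eq_prod, MeasureTheory.Measure.prod_prod]
    simp only [Real.volume_Ioc]
    exact ENNReal.mul_lt_top ENNReal.ofReal_lt_top ENNReal.ofReal_lt_top
  · refine (MeasureTheory.ae_restrict_iff' (measurableSet_Ioc.prod measurableSet_Ioc)).2
      (.of_forall fun x hx => ?_)
    exact hB x.1 (Set.Ioc_subset_Icc_self hx.1) x.2 (Set.Ioc_subset_Icc_self hx.2)

end LocallyBounded

section RenewalEquation

/-- Integrated form, for `t ≥ 2`, of the renewal equation with waiting times uniform on `[1, 2]`. -/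
theorem renewal_primitive {h : ℝ → ℝ} (hm : Measurable h) (hb : LocBounded h)
    (h0 : ∀ t < 1, h t = 0)
    (heq : ∀ t, h t = Set.indicator (Set.Icc 1 2) (fun x => x) t + ∫ s in (1:ℝ)..2, h (t - s))
    {t : ℝ} (ht : 2 ≤ t) :
    ∫ x in (0:ℝ)..t, h x = 3 / 2 + ∫ s in (t - 2)..(t - 1), ∫ x in (0:ℝ)..s, h x := by
  have hi := fun a b => hb.intervalIntegrable hm a b
  have hφ : IntervalIntegrable (Set.indicator (Set.Icc (1:ℝ) 2) (fun x => x))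
      MeasureTheory.volume 0 t := by
    refine LocBounded.intervalIntegrable (fun R => ⟨R, fun x hx => ?_⟩)
      (measurable_id.indicator measurableSet_Icc) _ _
    by_cases hx' : x ∈ Set.Icc (1:ℝ) 2
    · simpa [hx'] using hx
    · simpa [hx'] using (abs_nonneg x).trans hx
  have hT : IntervalIntegrable (fun r => ∫ s in (1:ℝ)..2, h (r - s))
      MeasureTheory.volume 0 t := by
    have : (fun r => ∫ s in (1:ℝ)..2, h (r - s))
        = fun r => h r - Set.indicator (Set.Icc (1:ℝ) 2) (fun x => x) r := by
      funext r; rw [heq r]; ring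
    rw [this]
    exact (hi _ _).sub hφ
  have hφ' : ∫ x in (0:ℝ)..t, Set.indicator (Set.Icc (1:ℝ) 2) (fun x => x) x = 3 / 2 := by
    rw [intervalIntegral.integral_of_le (by linarith),
      MeasureTheory.setIntegral_indicator measurableSet_Icc]
    have : Set.Ioc 0 t ∩ Set.Icc 1 2 = Set.Icc (1:ℝ) 2 := by
      ext x; simp only [Set.mem_inter_iff, Set.mem_Ioc, Set.mem_Icc]
      constructor
      · exact fun h => h.2
      · exact fun h => ⟨⟨by linarith [h.1], by linarith [h.2]⟩, h⟩
    rw [this, MeasureTheory.integral_Icc_eq_integral_Ioc,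
      ← intervalIntegral.integral_of_le (by norm_num), integral_id]
    norm_num
  have hneg : ∀ s : ℝ, 1 ≤ s → ∫ x in (-s)..0, h x = 0 := by
    intro s hs
    rw [intervalIntegral.integral_congr (g := fun _ => 0)]
    · simp
    · intro x hx
      rw [Set.uIcc_of_le (by linarith)] at hx
      exact h0 x (by linarith [hx.2])
  calc ∫ x in (0:ℝ)..t, h x
      = ∫ x in (0:ℝ)..t, (Set.indicator (Set.Icc (1:ℝ) 2) (fun x => x) x
          + ∫ s in (1:ℝ)..2, h (x - s)) := by
        refine intervalIntegral.integral_congr fun x _ => heq x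
    _ = 3 / 2 + ∫ x in (0:ℝ)..t, ∫ s in (1:ℝ)..2, h (x - s) := by
        rw [intervalIntegral.integral_add hφ hT, hφ']
    _ = 3 / 2 + ∫ s in (1:ℝ)..2, ∫ x in (0:ℝ)..t, h (x - s) := by
        obtain ⟨B, hB⟩ := hb (t + 2)
        congr 1
        refine intervalIntegral_swap_of_bounded (B := B) ?_ (by linarith) (by norm_num) ?_
        · exact hm.comp (measurable_fst.sub measurable_snd)
        · intro x hx y hy
          refine hB _ (abs_le.2 ⟨?_, ?_⟩)
          · linarith [hx.1, hy.2]
          · linarith [hx.2, hy.1]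
    _ = 3 / 2 + ∫ s in (1:ℝ)..2, ∫ x in (0:ℝ)..(t - s), h x := by
        congr 1
        refine intervalIntegral.integral_congr fun s hs => ?_
        rw [Set.uIcc_of_le (by norm_num)] at hs
        rw [intervalIntegral.integral_comp_sub_right, zero_sub,
          ← intervalIntegral.integral_add_adjacent_intervals (hi (-s) 0) (hi 0 (t - s)),
          hneg s hs.1, zero_add]
    _ = _ := by
        rw [intervalIntegral.integral_comp_sub_left (fun s => ∫ x in (0:ℝ)..s, h x)]

/-- After time `3` the deviation from the limit halves: the bound on the window `[t-3, t-2]`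
is improved by a factor two at `t`. -/
theorem renewal_halving {h : ℝ → ℝ} (hm : Measurable h) (hb : LocBounded h)
    (h0 : ∀ t < 1, h t = 0)
    (heq : ∀ t, h t = Set.indicator (Set.Icc 1 2) (fun x => x) t + ∫ s in (1:ℝ)..2, h (t - s))
    {t M : ℝ} (ht : 3 ≤ t) (hM : ∀ v ∈ Set.Icc (t - 3) (t - 2), |h v - 1| ≤ M) :
    |h t - 1| ≤ M / 2 := by
  have hi := fun a b => hb.intervalIntegrable hm a b
  set H : ℝ → ℝ := fun s => ∫ x in (0:ℝ)..s, h x with hH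
  have hHc : Continuous H := intervalIntegral.continuous_primitive hi 0
  have hdiff : ∀ a b, H b - H a = ∫ x in a..b, h x := fun a b =>
    intervalIntegral.integral_interval_sub_left (hi _ _) (hi _ _)
  have e1 : h t = H (t - 1) - H (t - 2) := by
    rw [hdiff, heq t, Set.indicator_of_notMem (by simp; intro; linarith), zero_add,
      intervalIntegral.integral_comp_sub_left h]
  have e2 : H (t - 1) = 3 / 2 + ∫ s in (t - 3)..(t - 2), H s := by
    have := renewal_primitive hm hb h0 heq (t := t - 1) (by linarith)
    rw [show t - 1 - 2 = t - 3 by ring, show t - 1 - 1 = t - 2 by ring] at this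
    exact this
  have e3 : ∫ s in (t - 3)..(t - 2), (H s - H (t - 2) + (t - 2 - s))
      = (∫ s in (t - 3)..(t - 2), H s) - H (t - 2) + 1 / 2 := by
    rw [intervalIntegral.integral_add, intervalIntegral.integral_sub,
      intervalIntegral.integral_sub, integral_id]
    · simp; ring
    all_goals exact Continuous.intervalIntegrable (by fun_prop) _ _
  have e4 : h t - 1 = ∫ s in (t - 3)..(t - 2), (H s - H (t - 2) + (t - 2 - s)) := by
    rw [e3, e1, e2]; ring
  have e5 : ∫ s in (t - 3)..(t - 2), M * (t - 2 - s) = M / 2 := by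
    rw [intervalIntegral.integral_const_mul, intervalIntegral.integral_sub, integral_id]
    · simp; ring
    all_goals exact Continuous.intervalIntegrable (by fun_prop) _ _
  rw [e4, ← e5, ← Real.norm_eq_abs]
  refine intervalIntegral.norm_integral_le_of_norm_le (by linarith) (.of_forall fun s hs => ?_)
    (Continuous.intervalIntegrable (by fun_prop) _ _)
  have e6 : H s - H (t - 2) + (t - 2 - s) = -∫ x in s..(t - 2), (h x - 1) := by
    rw [intervalIntegral.integral_sub (hi _ _) (by simp), ← hdiff]
    simp; ring
  rw [e6, norm_neg]
  refine (intervalIntegral.norm_integral_le_of_norm_le_const (C := M) fun x hx => ?_).trans ?_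
  · rw [Set.uIoc_of_le hs.2] at hx
    exact hM x ⟨by linarith [hx.1, hs.1], hx.2⟩
  · rw [abs_of_nonneg (by linarith [hs.2])]

theorem renewal_exp_decay {h : ℝ → ℝ} (hm : Measurable h) (hb : LocBounded h)
    (h0 : ∀ t < 1, h t = 0)
    (heq : ∀ t, h t = Set.indicator (Set.Icc 1 2) (fun x => x) t + ∫ s in (1:ℝ)..2, h (t - s))
    {a : ℝ} (ha : 0 ≤ a) (ha' : exp (a * 3) ≤ 2) :
    ∃ C > 0, ∀ t, 0 ≤ t → |h t - 1| ≤ C * exp (-a * t) := by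
  obtain ⟨B, hB⟩ := hb 3
  have hB0 : 0 ≤ B := (abs_nonneg _).trans (hB 0 (by simp))
  refine ⟨(B + 1) * exp (a * 3), by positivity, ?_⟩
  have key : ∀ n : ℕ, ∀ t : ℝ, 0 ≤ t → t ≤ n + 3 →
      |h t - 1| ≤ (B + 1) * exp (a * 3) * exp (-a * t) := by
    intro n
    induction n with
    | zero =>
      intro t ht ht'
      have h1 : |h t - 1| ≤ B + 1 := by
        refine (abs_sub _ _).trans ?_
        rw [abs_one]
        have := hB t (by rw [abs_of_nonneg ht]; simpa using ht')
        linarith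
      refine h1.trans ?_
      rw [mul_assoc, ← exp_add]
      refine le_mul_of_one_le_right (by positivity) (one_le_exp ?_)
      simp only [Nat.cast_zero, zero_add] at ht'
      nlinarith
    | succ n ih =>
      intro t ht ht'
      rcases le_or_gt t (n + 3) with h3 | h3
      · exact ih t ht h3
      push_cast at ht'
      have hn : (0:ℝ) ≤ n := n.cast_nonneg
      have := renewal_halving hm hb h0 heq (t := t)
        (M := (B + 1) * exp (a * 3) * exp (-a * (t - 3))) (by linarith) fun v hv => by
          refine (ih v (by linarith [hv.1]) (by linarith [hv.2])).trans ?_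
          have : -a * v ≤ -a * (t - 3) := by nlinarith [hv.1]
          gcongr
      refine this.trans ?_
      rw [show -a * (t - 3) = a * 3 + -a * t by ring, exp_add (a * 3)]
      have hp : 0 < (B + 1) * exp (a * 3) * exp (-a * t) := by positivity
      nlinarith
  intro t ht
  obtain ⟨n, hn⟩ := exists_nat_ge t
  exact key n t ht (by linarith)

end RenewalEquation

section ConvolutionPowers

/-- The additive convolution powers of the indicator of `[1, 2]`; `unifPow n` is the
`(n+1)`-st power. -/
noncomputable def unifPow : ℕ → ℝ → ℝ
  | 0 => Set.indicator (Set.Icc 1 2) 1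
  | n + 1 => fun t => ∫ s in (1:ℝ)..2, unifPow n (t - s)

theorem unifPow_bounds (n : ℕ) :
    Measurable (unifPow n) ∧ (∀ t, 0 ≤ unifPow n t ∧ unifPow n t ≤ 1) ∧
      ∀ t < (n : ℝ) + 1, unifPow n t = 0 := by
  induction n with
  | zero =>
    refine ⟨measurable_one.indicator measurableSet_Icc, fun t => ?_, fun t ht => ?_⟩
    · by_cases h : t ∈ Set.Icc (1:ℝ) 2 <;> simp [unifPow, h]
    · refine Set.indicator_of_notMem (fun h => ?_) _
      simp only [Nat.cast_zero, zero_add] at ht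
      exact absurd h.1 (not_le.2 ht)
  | succ n ih =>
    obtain ⟨hm, hb, hz⟩ := ih
    have hlb : LocBounded (unifPow n) := fun R => ⟨1, fun x _ => by
      rw [abs_of_nonneg (hb x).1]; exact (hb x).2⟩
    have hi := fun a b => hlb.intervalIntegrable hm a b
    have hi' := fun t : ℝ => (hlb.comp_sub t).intervalIntegrable (hm.comp (by fun_prop)) 1 2
    refine ⟨?_, fun t => ⟨?_, ?_⟩, fun t ht => ?_⟩
    · have : unifPow (n + 1)
          = fun t => (∫ x in (0:ℝ)..(t - 1), unifPow n x) - ∫ x in (0:ℝ)..(t - 2), unifPow n x := by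
        funext t
        rw [intervalIntegral.integral_interval_sub_left (hi _ _) (hi _ _)]
        exact intervalIntegral.integral_comp_sub_left (unifPow n) t
      rw [this]
      have hc := intervalIntegral.continuous_primitive hi 0
      exact ((hc.comp (continuous_id.sub continuous_const)).sub
        (hc.comp (continuous_id.sub continuous_const))).measurable
    · exact intervalIntegral.integral_nonneg (by norm_num) fun s _ => (hb _).1
    · calc ∫ s in (1:ℝ)..2, unifPow n (t - s) ≤ ∫ s in (1:ℝ)..2, (1:ℝ) :=
            intervalIntegral.integral_mono_on (by norm_num) (hi' t) (by simp) fun s _ => (hb _).2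
        _ = 1 := by norm_num
    · push_cast at ht
      calc ∫ s in (1:ℝ)..2, unifPow n (t - s) = ∫ s in (1:ℝ)..2, (0:ℝ) := by
            refine intervalIntegral.integral_congr fun s hs => hz _ ?_
            rw [Set.uIcc_of_le (by norm_num)] at hs
            linarith [hs.1]
        _ = 0 := by simp

theorem measurable_unifPow (n : ℕ) : Measurable (unifPow n) := (unifPow_bounds n).1

theorem abs_unifPow_le (n : ℕ) (t : ℝ) : |unifPow n t| ≤ 1 := by
  have := (unifPow_bounds n).2.1 t
  rw [abs_of_nonneg this.1]; exact this.2

theorem unifPow_eq_zero {n : ℕ} {t : ℝ} (ht : t < (n : ℝ) + 1) : unifPow n t = 0 :=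
  (unifPow_bounds n).2.2 t ht

theorem locBounded_unifPow (n : ℕ) : LocBounded (unifPow n) :=
  fun _ => ⟨1, fun x _ => abs_unifPow_le n x⟩

/-- Multiplication by the variable is a derivation for convolution. -/
theorem mul_unifPow_succ (n : ℕ) (t : ℝ) :
    t * unifPow (n + 1) t = (∫ s in (1:ℝ)..2, (t - s) * unifPow n (t - s))
      + ∫ s in (1:ℝ)..2, s * unifPow n (t - s) := by
  have hm : Measurable fun s => unifPow n (t - s) :=
    (measurable_unifPow n).comp (by fun_prop)
  have hb := (locBounded_unifPow n).comp_sub t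
  rw [← intervalIntegral.integral_add
    (((locBounded_id.comp_sub t).mul hb).intervalIntegrable (by fun_prop) _ _)
    ((locBounded_id.mul hb).intervalIntegrable (by fun_prop) _ _)]
  simp only [unifPow]
  rw [← intervalIntegral.integral_const_mul]
  exact intervalIntegral.integral_congr fun s _ => by ring

theorem intervalIntegral_eq_integral_unifPow_zero_mul (k : ℝ → ℝ) :
    ∫ s in (1:ℝ)..2, k s = ∫ s, unifPow 0 s * k s := by
  rw [intervalIntegral.integral_of_le (by norm_num), ← MeasureTheory.integral_Icc_eq_integral_Ioc,
    ← MeasureTheory.integral_indicator measurableSet_Icc]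
  congr 1
  funext s
  by_cases h : s ∈ Set.Icc (1:ℝ) 2 <;> simp [unifPow, h]

theorem integral_sub_mul_unifPow (n : ℕ) : ∀ t : ℝ,
    ∫ s in (1:ℝ)..2, (t - s) * unifPow n (t - s)
      = (n + 1) * ∫ s in (1:ℝ)..2, s * unifPow n (t - s) := by
  induction n with
  | zero =>
    intro t
    rw [intervalIntegral_eq_integral_unifPow_zero_mul, intervalIntegral_eq_integral_unifPow_zero_mul,
      ← MeasureTheory.integral_sub_left_eq_self _ _ t]
    simp only [Nat.cast_zero, zero_add, one_mul, sub_sub_cancel]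
    congr 1
    funext s
    ring
  | succ n ih =>
    intro t
    have hm := measurable_unifPow n
    have h1 : ∫ s in (1:ℝ)..2, (t - s) * unifPow (n + 1) (t - s)
        = (n + 2) * ∫ s in (1:ℝ)..2, ∫ r in (1:ℝ)..2, r * unifPow n (t - s - r) := by
      rw [← intervalIntegral.integral_const_mul]
      refine intervalIntegral.integral_congr fun s _ => ?_
      rw [mul_unifPow_succ, ih]
      ring
    have h2 : ∫ s in (1:ℝ)..2, ∫ r in (1:ℝ)..2, r * unifPow n (t - s - r)
        = ∫ r in (1:ℝ)..2, ∫ s in (1:ℝ)..2, r * unifPow n (t - s - r) := by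
      refine intervalIntegral_swap_of_bounded (B := 2) ?_ (by norm_num) (by norm_num) ?_
      · exact measurable_snd.mul
          (hm.comp ((measurable_const.sub measurable_fst).sub measurable_snd))
      · intro s _ r hr
        rw [abs_mul, abs_of_nonneg (by linarith [hr.1])]
        have := abs_unifPow_le n (t - s - r)
        nlinarith [hr.1, hr.2]
    rw [h1, h2]
    push_cast
    rw [show (n : ℝ) + 1 + 1 = n + 2 by ring]
    congr 1
    refine intervalIntegral.integral_congr fun r _ => ?_
    simp only [unifPow]
    rw [intervalIntegral.integral_const_mul]
    congr 2
    funext s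
    congr 1
    ring

theorem mul_unifPow_succ_div (n : ℕ) (t : ℝ) :
    t * unifPow (n + 1) t / ((n + 1 : ℕ) + 1)
      = ∫ s in (1:ℝ)..2, (t - s) * unifPow n (t - s) / (n + 1) := by
  have hn : (n : ℝ) + 1 ≠ 0 := by positivity
  have hn' : (n : ℝ) + 1 + 1 ≠ 0 := by positivity
  rw [mul_unifPow_succ, intervalIntegral.integral_div, integral_sub_mul_unifPow]
  push_cast
  field_simp

theorem chiPow_exp (n : ℕ) : ∀ t : ℝ, chiPow n (exp t) = unifPow n t := by
  have hchi : ∀ t : ℝ, chi (exp t) = unifPow 0 t := by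
    intro t
    by_cases h : t ∈ Set.Icc (1:ℝ) 2
    · have h' : exp t ∈ Set.Icc (exp 1) (exp 2) := ⟨exp_le_exp.2 h.1, exp_le_exp.2 h.2⟩
      simp [chi, unifPow, h, h']
    · have h' : exp t ∉ Set.Icc (exp 1) (exp 2) :=
        fun h' => h ⟨exp_le_exp.1 h'.1, exp_le_exp.1 h'.2⟩
      simp only [chi, unifPow, Set.indicator_of_notMem h, Set.indicator_of_notMem h']
  induction n with
  | zero => exact hchi
  | succ n ih =>
    intro t
    rcases lt_or_ge t 0 with ht | ht
    · rw [unifPow_eq_zero (by push_cast; have : (0:ℝ) ≤ n := n.cast_nonneg; linarith)]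
      simp only [chiPow, mconv]
      rw [intervalIntegral.integral_congr (g := fun _ => 0)]
      · simp
      · intro u hu
        rw [Set.uIcc_of_ge (exp_le_one_iff.2 ht.le)] at hu
        have : chi u = 0 := by
          refine Set.indicator_of_notMem (fun h => ?_) _
          have := add_one_lt_exp (x := 1) one_ne_zero
          linarith [h.1, hu.2]
        simp [this]
    · have himg : Set.image exp (Set.Ioc 0 t) = Set.Ioc 1 (exp t) := by
        ext u
        constructor
        · rintro ⟨x, hx, rfl⟩
          exact ⟨one_lt_exp_iff.2 hx.1, exp_le_exp.2 hx.2⟩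
        · intro hu
          have hu0 : 0 < u := by linarith [hu.1]
          exact ⟨log u, ⟨log_pos hu.1, (log_le_iff_le_exp hu0).2 hu.2⟩, exp_log hu0⟩
      simp only [chiPow, mconv]
      rw [intervalIntegral.integral_of_le (one_le_exp ht), ← himg,
        MeasureTheory.integral_image_eq_integral_abs_deriv_smul measurableSet_Ioc
          (fun x _ => (hasDerivAt_exp x).hasDerivWithinAt) exp_injective.injOn]
      simp only [unifPow]
      rw [intervalIntegral_eq_integral_unifPow_zero_mul,
        ← MeasureTheory.setIntegral_eq_integral_of_forall_compl_eq_zero (s := Set.Ioc 0 t)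
          (f := fun s => unifPow 0 s * unifPow n (t - s))]
      · refine MeasureTheory.setIntegral_congr_fun measurableSet_Ioc fun s _ => ?_
        have hs := exp_pos s
        simp only [smul_eq_mul]
        rw [abs_of_pos hs, hchi, ← exp_sub, ih]
        field_simp
      · intro s hs
        rcases le_or_gt s 0 with h | h
        · rw [unifPow_eq_zero (by push_cast; linarith), zero_mul]
        · have h' : t < s := by
            by_contra hc
            exact hs ⟨h, not_lt.1 hc⟩
          rw [unifPow_eq_zero (n := n)
            (by have : (0:ℝ) ≤ n := n.cast_nonneg; linarith), mul_zero]

/-- `t g(eᵗ)` as a series of convolution powers. -/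
noncomputable def renewalSeries (t : ℝ) : ℝ := ∑' n : ℕ, t * unifPow n t / (n + 1)

theorem g_mul_log_eq {u : ℝ} (hu : 0 < u) : g u * log u = renewalSeries (log u) := by
  rw [g, renewalSeries, ← tsum_mul_right]
  refine tsum_congr fun n => ?_
  have := chiPow_exp n (log u)
  rw [exp_log hu] at this
  rw [this]
  ring

theorem renewalSeries_eq_sum {N : ℕ} {t : ℝ} (ht : t ≤ N) :
    renewalSeries t = ∑ n ∈ Finset.range N, t * unifPow n t / (n + 1) := by
  refine tsum_eq_sum fun n hn => ?_
  have : (N : ℝ) ≤ n := by exact_mod_cast not_lt.1 (fun h => hn (Finset.mem_range.2 h))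
  rw [unifPow_eq_zero (by linarith), mul_zero, zero_div]

theorem locBounded_term (n : ℕ) :
    LocBounded fun t => t * unifPow n t / (n + 1) := by
  intro R
  refine ⟨R, fun x hx => ?_⟩
  have h1 := abs_unifPow_le n x
  have hn : (0:ℝ) ≤ n := n.cast_nonneg
  rw [abs_div, abs_mul, abs_of_pos (by positivity : (0:ℝ) < n + 1), div_le_iff₀ (by positivity)]
  nlinarith [abs_nonneg x, abs_nonneg (unifPow n x)]

theorem measurable_term (n : ℕ) : Measurable fun t => t * unifPow n t / (n + 1) :=
  (measurable_id.mul (measurable_unifPow n)).div_const _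

theorem measurable_renewalSeries : Measurable renewalSeries := by
  refine measurable_of_tendsto_metrizable
    (f := fun N t => ∑ n ∈ Finset.range N, t * unifPow n t / (n + 1))
    (fun N => Finset.measurable_fun_sum _ fun n _ => measurable_term n) ?_
  rw [tendsto_pi_nhds]
  intro t
  obtain ⟨N, hN⟩ := exists_nat_ge t
  refine tendsto_const_nhds.congr' ?_
  filter_upwards [Filter.eventually_ge_atTop N] with M hM
  exact renewalSeries_eq_sum (hN.trans (by exact_mod_cast hM))

theorem locBounded_renewalSeries : LocBounded renewalSeries := by
  intro R
  obtain ⟨N, hN⟩ := exists_nat_ge R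
  choose B hB using fun n => locBounded_term n R
  refine ⟨∑ n ∈ Finset.range N, B n, fun x hx => ?_⟩
  rw [renewalSeries_eq_sum ((le_abs_self x).trans (hx.trans hN))]
  exact (Finset.abs_sum_le_sum_abs _ _).trans (Finset.sum_le_sum fun n _ => hB n x hx)

theorem renewalSeries_eq_zero {t : ℝ} (ht : t < 1) : renewalSeries t = 0 := by
  rw [renewalSeries_eq_sum (N := 1) (by simpa using ht.le)]
  simp [unifPow_eq_zero (n := 0) (t := t) (by simpa using ht)]

theorem renewalSeries_eq (t : ℝ) :
    renewalSeries t = Set.indicator (Set.Icc 1 2) (fun x => x) t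
      + ∫ s in (1:ℝ)..2, renewalSeries (t - s) := by
  obtain ⟨N, hN⟩ := exists_nat_ge t
  rw [renewalSeries_eq_sum (N := N + 1) (by push_cast; linarith), Finset.sum_range_succ', add_comm]
  congr 1
  · by_cases h : t ∈ Set.Icc (1:ℝ) 2 <;> simp [unifPow, h]
  · simp only [mul_unifPow_succ_div]
    rw [← intervalIntegral.integral_finsetSum fun n _ =>
      ((locBounded_term n).comp_sub t).intervalIntegrable
        ((measurable_term n).comp (measurable_const.sub measurable_id)) 1 2]
    refine intervalIntegral.integral_congr fun s hs => ?_
    rw [Set.uIcc_of_le (by norm_num)] at hs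
    exact (renewalSeries_eq_sum (by linarith [hs.1])).symm

end ConvolutionPowers

/-- There is `C > 0` such that `|g(u) log u - 1| ≤ C u^{-(1/2) log(π/2)}` for `u > e²`. -/
theorem g_estimate :
    ∃ C > 0, ∀ u : ℝ, Real.exp 2 < u →
      |g u * Real.log u - 1| ≤ C * u ^ (-(1/2) * Real.log (π / 2)) := by
  have hpi : 0 < log (π / 2) := log_pos (by linarith [pi_gt_three])
  have hexp : exp (1 / 2 * log (π / 2) * 3) ≤ 2 := by
    rw [← le_log_iff_exp_le (by norm_num)]
    have h1 : log ((π / 2) ^ 3) ≤ log (2 ^ 2) := by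
      refine log_le_log (by positivity) ?_
      have : (π / 2) ^ 3 ≤ (3.15 / 2) ^ 3 := by
        gcongr
        exact pi_lt_d2.le
      exact this.trans (by norm_num)
    rw [log_pow, log_pow] at h1
    push_cast at h1
    linarith
  obtain ⟨C, hC, hmain⟩ := renewal_exp_decay measurable_renewalSeries locBounded_renewalSeries
    (fun t => renewalSeries_eq_zero) renewalSeries_eq (by positivity) hexp
  refine ⟨C, hC, fun u hu => ?_⟩
  have hu1 : 1 ≤ u := (one_le_exp (by norm_num)).trans hu.le
  have hu0 : 0 < u := by linarith
  rw [g_mul_log_eq hu0, rpow_def_of_pos hu0]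
  refine (hmain _ (log_nonneg hu1)).trans_eq ?_
  congr 2
  ring
end

section
/- With β ∈ (0,1), l_k = 4^k, γ_k = exp(4^{βk}), ρ_k = 1 - 4^{-k} + iγ_k, and f_C defined as in the continuous example, for Re(s) > 1 one has exp(∫₁^∞ v^{-s} f_C(v) dv) = (s/(s-1)) ∏_{k=1}^∞ G(l_k(s-ρ_k)) G(l_k(s-conj(ρ_k))). -/
open Complex Real

/-- `G(z) = 1 - (e^{-z} - e^{-2z})/z` for `z ≠ 0`, with `G(0) = 0`. -/
noncomputable def G (z : ℂ) : ℂ :=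
  if z = 0 then 0 else 1 - (Complex.exp (-z) - Complex.exp (-2 * z)) / z

/-- `γ_k = exp(4^{βk})`. -/
noncomputable def γ (β : ℝ) (k : ℕ) : ℝ := Real.exp ((4:ℝ) ^ (β * k))

/-- `ρ_k = 1 - 4^{-k} + i γ_k`. -/
noncomputable def ρ (β : ℝ) (k : ℕ) : ℂ := 1 - 1 / 4 ^ k + Complex.I * (γ β k : ℝ)

/-- `f_C(v) = (1 - v⁻¹)/log v - 2 ∑_{k≥1} (g(v^{1/4^k})/4^k) v^{-1/4^k} cos(γ_k log v)`. -/
noncomputable def fC (β : ℝ) (v : ℝ) : ℝ :=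
  (1 - v⁻¹) / Real.log v -
    2 * ∑' k : ℕ, g (v ^ (((4:ℝ) ^ (k + 1))⁻¹)) / (4:ℝ) ^ (k + 1) *
      v ^ (-((4:ℝ) ^ (k + 1))⁻¹) * Real.cos (γ β (k + 1) * Real.log v)

open MeasureTheory Set

/-- The `(n+1)`-fold additive self-convolution of the indicator function of `[1, 2]`. -/
noncomputable def addPow : ℕ → ℝ → ℝ
  | 0 => indicator (Icc 1 2) 1
  | n + 1 => fun x => ∫ y, indicator (Icc 1 2) 1 y * addPow n (x - y)

theorem addPow_nonneg (n : ℕ) (x : ℝ) : 0 ≤ addPow n x := by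
  induction n generalizing x with
  | zero => exact indicator_nonneg (fun _ _ => zero_le_one) x
  | succ n ih =>
    exact integral_nonneg fun y => mul_nonneg (indicator_nonneg (fun _ _ => zero_le_one) y) (ih _)

theorem addPow_eq_zero (n : ℕ) {x : ℝ} (hx : x < n + 1) : addPow n x = 0 := by
  induction n generalizing x with
  | zero => exact indicator_of_notMem (fun h => by simp at hx; linarith [h.1]) _
  | succ n ih =>
    push_cast at hx
    refine integral_eq_zero_of_ae (Filter.Eventually.of_forall fun y => ?_)
    by_cases hy : y ∈ Icc (1 : ℝ) 2
    · simp [ih (x := x - y) (by linarith [hy.1])]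
    · simp [indicator_of_notMem hy]

theorem chi_exp (x : ℝ) : chi (Real.exp x) = indicator (Icc 1 2) 1 x := by
  simp [chi, indicator]

theorem chiPow_exp_s11 (n : ℕ) (x : ℝ) : chiPow n (Real.exp x) = addPow n x := by
  induction n generalizing x with
  | zero => exact chi_exp x
  | succ n ih =>
    have hF : ∀ y : ℝ, Real.exp y * (chiPow n (Real.exp x / Real.exp y) * chi (Real.exp y) /
        Real.exp y) = indicator (Icc 1 2) 1 y * addPow n (x - y) := fun y => by
      rw [← Real.exp_sub, ih, chi_exp]
      field_simp
    rcases le_or_gt 0 x with hx | hx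
    · change ∫ u in (1:ℝ)..Real.exp x, chiPow n (Real.exp x / u) * chi u / u = _
      rw [intervalIntegral.integral_of_le (Real.one_le_exp hx)]
      have h1 : ∫ u in Ioc 1 (Real.exp x), chiPow n (Real.exp x / u) * chi u / u =
          ∫ u in Ioi (Real.exp 0), chiPow n (Real.exp x / u) * chi u / u := by
        rw [Real.exp_zero]
        refine (setIntegral_eq_of_subset_of_forall_sdiff_eq_zero measurableSet_Ioi
          (fun u hu => hu.1) ?_).symm
        rintro u ⟨hu1, hu2⟩
        have hu1 : 1 < u := hu1
        have hu3 : Real.exp x < u := by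
          by_contra! h
          exact hu2 ⟨hu1, h⟩
        have hu0 : 0 < u := by linarith
        rw [← Real.exp_log hu0, ← Real.exp_sub, ih, addPow_eq_zero]
        · simp
        · have := (Real.lt_log_iff_exp_lt hu0).2 hu3
          have : (0:ℝ) ≤ n := n.cast_nonneg
          linarith
      rw [h1, ← integral_comp_exp_Ioi]
      simp_rw [smul_eq_mul, hF]
      refine setIntegral_eq_integral_of_forall_compl_eq_zero fun y hy => ?_
      rw [indicator_of_notMem (fun h => hy (by have := h.1; simp; linarith)), zero_mul]
    · rw [addPow_eq_zero _ (by have : (0:ℝ) ≤ (n+1 : ℕ) := Nat.cast_nonneg _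
                               linarith)]
      refine intervalIntegral.integral_zero_ae (Filter.Eventually.of_forall fun u hu => ?_)
      rw [uIoc_of_ge (Real.exp_le_one_iff.2 hx.le)] at hu
      have : chi u = 0 := indicator_of_notMem (fun h => by
        have := h.1
        have := hu.2
        have := Real.add_one_lt_exp (x := 1) (by norm_num)
        linarith) _
      simp [this]

/-- The Laplace transform of the indicator function of `[1, 2]`. -/
noncomputable def laplaceChi (z : ℂ) : ℂ := ∫ x in (1:ℝ)..2, Complex.exp (-z * x)

theorem laplace_addPow_zero (z : ℂ) :
    Integrable (fun x : ℝ => Complex.exp (-z * x) * addPow 0 x) ∧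
      ∫ x : ℝ, Complex.exp (-z * x) * addPow 0 x = laplaceChi z := by
  have h : (fun x : ℝ => Complex.exp (-z * x) * addPow 0 x) =
      indicator (Icc 1 2) fun x : ℝ => Complex.exp (-z * x) := by
    ext x
    by_cases hx : x ∈ Icc (1:ℝ) 2 <;> simp [addPow, hx]
  rw [h]
  refine ⟨(integrable_indicator_iff measurableSet_Icc).2
    (Continuous.integrableOn_Icc (by fun_prop)), ?_⟩
  rw [integral_indicator measurableSet_Icc, laplaceChi,
    intervalIntegral.integral_of_le (by norm_num), integral_Icc_eq_integral_Ioc]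

theorem laplace_addPow (n : ℕ) (z : ℂ) :
    Integrable (fun x : ℝ => Complex.exp (-z * x) * addPow n x) ∧
      ∫ x : ℝ, Complex.exp (-z * x) * addPow n x = laplaceChi z ^ (n + 1) := by
  induction n with
  | zero => simpa using laplace_addPow_zero z
  | succ n ih =>
    have h0 := laplace_addPow_zero z
    have h : (fun x : ℝ => Complex.exp (-z * x) * addPow (n + 1) x) =
        convolution (fun x : ℝ => Complex.exp (-z * x) * addPow 0 x)
          (fun x : ℝ => Complex.exp (-z * x) * addPow n x) (ContinuousLinearMap.mul ℂ ℂ) := by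
      ext x
      simp only [convolution, ContinuousLinearMap.mul_apply', addPow]
      rw [← integral_complex_ofReal, ← integral_const_mul]
      congr 1
      ext y
      have : Complex.exp (-z * x) = Complex.exp (-z * y) * Complex.exp (-z * (x - y : ℝ)) := by
        rw [← Complex.exp_add]
        push_cast
        ring_nf
      rw [this]
      push_cast
      ring
    rw [h]
    refine ⟨h0.1.integrable_convolution _ ih.1, ?_⟩
    rw [integral_convolution _ h0.1 ih.1, h0.2, ih.2, ContinuousLinearMap.mul_apply']
    ring

theorem G_eq_one_sub_laplaceChi {z : ℂ} (hz : z ≠ 0) : G z = 1 - laplaceChi z := by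
  rw [G, if_neg hz, laplaceChi, integral_exp_mul_complex (neg_ne_zero.2 hz)]
  push_cast
  field_simp
  ring_nf

theorem norm_laplaceChi_le {z : ℂ} (hz : 0 < z.re) : ‖laplaceChi z‖ ≤ Real.exp (-z.re) := by
  have := intervalIntegral.norm_integral_le_of_norm_le_const (a := 1) (b := 2)
    (f := fun x : ℝ => Complex.exp (-z * x)) (C := Real.exp (-z.re)) (fun x hx => by
      rw [uIoc_of_le (by norm_num)] at hx
      rw [Complex.norm_exp]
      simp only [Complex.mul_re, Complex.neg_re, Complex.ofReal_re, Complex.ofReal_im]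
      refine Real.exp_le_exp.2 ?_
      nlinarith [hx.1])
  refine this.trans_eq ?_
  norm_num
theorem integrable_tsum_of_summable_integral_norm {α : Type*} {m : MeasurableSpace α}
    {μ : Measure α} {F : ℕ → α → ℂ} (hF : ∀ i, Integrable (F i) μ)
    (hsum : Summable fun i => ∫ a, ‖F i a‖ ∂μ) : Integrable (fun a => ∑' i, F i a) μ := by
  refine ⟨(AEMeasurable.tsum fun i => (hF i).1.aemeasurable).aestronglyMeasurable, ?_⟩
  have h (i : ℕ) : ∫⁻ a, ‖F i a‖ₑ ∂μ = ENNReal.ofReal (∫ a, ‖F i a‖ ∂μ) := by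
    rw [ofReal_integral_norm_eq_lintegral_enorm (hF i)]
  calc ∫⁻ a, ‖∑' i, F i a‖ₑ ∂μ ≤ ∫⁻ a, ∑' i, ‖F i a‖ₑ ∂μ :=
        lintegral_mono fun a => enorm_tsum_le_tsum_enorm
    _ = ∑' i, ENNReal.ofReal (∫ a, ‖F i a‖ ∂μ) := by
        rw [lintegral_tsum fun i => (hF i).1.enorm]
        simp_rw [h]
    _ < ⊤ := hsum.tsum_ofReal_lt_top

theorem g_exp (x : ℝ) : g (Real.exp x) = ∑' n : ℕ, addPow n x / (n + 1) := by
  simp_rw [g, chiPow_exp_s11]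

theorem g_exp_nonneg (x : ℝ) : 0 ≤ g (Real.exp x) := by
  rw [g_exp]
  exact tsum_nonneg fun n => div_nonneg (addPow_nonneg n x) (by positivity)

theorem g_exp_of_lt_one {x : ℝ} (hx : x < 1) : g (Real.exp x) = 0 := by
  rw [g_exp]
  have (n : ℕ) : addPow n x / (n + 1) = 0 := by
    rw [addPow_eq_zero n (by linarith [n.cast_nonneg (α := ℝ)]), zero_div]
  simp [this]

theorem norm_laplaceChi_lt_one {z : ℂ} (hz : 0 < z.re) : ‖laplaceChi z‖ < 1 :=
  (norm_laplaceChi_le hz).trans_lt (Real.exp_zero ▸ Real.exp_lt_exp.2 (by linarith))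

theorem norm_exp_mul_ofReal (z : ℂ) (x : ℝ) {a : ℝ} (ha : 0 ≤ a) :
    ((‖Complex.exp (-z * x) * a‖ : ℝ) : ℂ) = Complex.exp (-(z.re : ℂ) * x) * a := by
  rw [norm_mul, Complex.norm_exp, Complex.norm_real, Real.norm_of_nonneg ha]
  simp

/-- The Laplace transform of `x ↦ g (exp x)` is `-log (1 - laplaceChi z)`. -/
theorem laplace_g {z : ℂ} (hz : 0 < z.re) :
    Integrable (fun x : ℝ => Complex.exp (-z * x) * g (Real.exp x)) ∧
      ∫ x : ℝ, Complex.exp (-z * x) * g (Real.exp x) = -Complex.log (1 - laplaceChi z) := by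
  have hF (n : ℕ) : Integrable fun x : ℝ => Complex.exp (-z * x) * (addPow n x / (n + 1) : ℝ) := by
    convert (laplace_addPow n z).1.div_const ((n : ℂ) + 1) using 2
    push_cast
    ring
  have hFint (n : ℕ) : ∫ x : ℝ, Complex.exp (-z * x) * (addPow n x / (n + 1) : ℝ) =
      laplaceChi z ^ (n + 1) / ((n + 1 : ℕ) : ℂ) := by
    rw [← (laplace_addPow n z).2, ← integral_div]
    congr 1
    ext x
    push_cast
    ring
  have hre : 0 < (z.re : ℂ).re := by simpa
  have hnorm (n : ℕ) : ∫ x : ℝ, ‖Complex.exp (-z * x) * (addPow n x / (n + 1) : ℝ)‖ ≤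
      ‖laplaceChi z.re‖ ^ n := by
    have h1 : ((∫ x : ℝ, ‖Complex.exp (-z * x) * (addPow n x / (n + 1) : ℝ)‖ : ℝ) : ℂ) =
        laplaceChi z.re ^ (n + 1) / ((n : ℂ) + 1) := by
      rw [← integral_complex_ofReal, ← (laplace_addPow n z.re).2, ← integral_div]
      congr 1
      ext x
      rw [norm_exp_mul_ofReal z x (div_nonneg (addPow_nonneg n x) (by positivity))]
      push_cast
      ring
    have h2 : ‖(n : ℂ) + 1‖ = n + 1 := by
      exact_mod_cast Complex.norm_natCast (n + 1)
    have h3 := congrArg norm h1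
    rw [Complex.norm_real, norm_div, norm_pow, h2] at h3
    refine (le_abs_self _).trans (h3.trans_le ?_)
    have h4 := norm_laplaceChi_lt_one hre
    have h5 : ‖laplaceChi z.re‖ ^ (n + 1) ≤ ‖laplaceChi z.re‖ ^ n :=
      pow_le_pow_of_le_one (norm_nonneg _) h4.le n.le_succ
    exact (div_le_self (by positivity) (by linarith [n.cast_nonneg (α := ℝ)])).trans h5
  have hsum : Summable fun n : ℕ =>
      ∫ x : ℝ, ‖Complex.exp (-z * x) * (addPow n x / (n + 1) : ℝ)‖ :=
    Summable.of_nonneg_of_le (fun n => integral_nonneg fun x => norm_nonneg _) hnorm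
      (summable_geometric_of_lt_one (norm_nonneg _) (norm_laplaceChi_lt_one hre))
  have hg : (fun x : ℝ => Complex.exp (-z * x) * g (Real.exp x)) =
      fun x : ℝ => ∑' n : ℕ, Complex.exp (-z * x) * (addPow n x / (n + 1) : ℝ) := by
    ext x
    rw [tsum_mul_left, g_exp, Complex.ofReal_tsum]
  rw [hg]
  refine ⟨integrable_tsum_of_summable_integral_norm hF hsum, ?_⟩
  have h1 := hasSum_integral_of_summable_integral_norm hF hsum
  have h2 := Complex.hasSum_taylorSeries_neg_log (norm_laplaceChi_lt_one hz)
  rw [← hasSum_nat_add_iff' 1] at h2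
  simp only [hFint] at h1
  simpa using h1.unique h2

theorem integral_norm_laplace_g_le {z : ℂ} (hz : 1 ≤ z.re) :
    ∫ x : ℝ, ‖Complex.exp (-z * x) * g (Real.exp x)‖ ≤ 3 / 2 * Real.exp (-z.re) := by
  have hre : 0 < (z.re : ℂ).re := by simp; linarith
  have h1 : ((∫ x : ℝ, ‖Complex.exp (-z * x) * g (Real.exp x)‖ : ℝ) : ℂ) =
      -Complex.log (1 + -laplaceChi z.re) := by
    rw [← integral_complex_ofReal, ← sub_eq_add_neg, ← (laplace_g hre).2]
    congr 1
    ext x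
    rw [norm_exp_mul_ofReal z x (g_exp_nonneg x)]
  have h2 := norm_laplaceChi_le hre
  rw [Complex.ofReal_re] at h2
  have h3 : Real.exp (-z.re) ≤ 1 / 2 := by
    rw [Real.exp_neg, one_div]
    refine inv_anti₀ (by norm_num) ?_
    linarith [Real.add_one_le_exp z.re]
  have h4 := Complex.norm_log_one_add_half_le_self (z := -laplaceChi z.re)
    (by rw [norm_neg]; exact h2.trans h3)
  have h5 := congrArg norm h1
  rw [Complex.norm_real, norm_neg] at h5
  refine (le_abs_self _).trans (h5.trans_le (h4.trans ?_))
  rw [norm_neg]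
  gcongr

theorem exp_log_one_sub_laplaceChi {z : ℂ} (hz : 0 < z.re) :
    Complex.exp (Complex.log (1 - laplaceChi z)) = G z := by
  rw [G_eq_one_sub_laplaceChi (fun h => by simp [h] at hz), Complex.exp_log]
  intro h
  have h1 := norm_laplaceChi_lt_one hz
  rw [← sub_eq_zero.1 h, norm_one] at h1
  exact lt_irrefl _ h1

/-- The `k`-th term of the series defining `fC`, at `v = exp x`, times `v ^ (1 - s)`. -/
noncomputable def zeroTerm (β : ℝ) (s : ℂ) (k : ℕ) (x : ℝ) : ℂ :=
  Complex.exp ((1 - s) * x) * (2 * (g (Real.exp x ^ (((4:ℝ) ^ (k + 1))⁻¹)) / (4:ℝ) ^ (k + 1) *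
      Real.exp x ^ (-((4:ℝ) ^ (k + 1))⁻¹) * Real.cos (γ β (k + 1) * Real.log (Real.exp x))) : ℝ)

theorem zeroTerm_eq (β : ℝ) (s : ℂ) (k : ℕ) (x : ℝ) :
    zeroTerm β s k x = ((4:ℂ) ^ (k + 1))⁻¹ *
      (Complex.exp (-((4:ℂ) ^ (k + 1) * (s - ρ β (k + 1))) * (x / (4:ℝ) ^ (k + 1) : ℝ)) *
          g (Real.exp (x / (4:ℝ) ^ (k + 1))) +
        Complex.exp (-((4:ℂ) ^ (k + 1) * (s - (starRingEnd ℂ) (ρ β (k + 1)))) *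
            (x / (4:ℝ) ^ (k + 1) : ℝ)) * g (Real.exp (x / (4:ℝ) ^ (k + 1)))) := by
  have hl : (4:ℂ) ^ (k + 1) ≠ 0 := pow_ne_zero _ (by norm_num)
  rw [zeroTerm, Real.log_exp, ← Real.exp_mul, ← Real.exp_mul, ← div_eq_mul_inv]
  have h1 : Complex.exp (-((4:ℂ) ^ (k + 1) * (s - ρ β (k + 1))) * (x / (4:ℝ) ^ (k + 1) : ℝ)) =
      Complex.exp ((1 - s) * x) * Complex.exp (x * -((4:ℂ) ^ (k + 1))⁻¹) *
        Complex.exp (γ β (k + 1) * x * Complex.I) := by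
    rw [← Complex.exp_add, ← Complex.exp_add, ρ]
    congr 1
    push_cast
    field_simp
    ring
  have h2 : Complex.exp (-((4:ℂ) ^ (k + 1) * (s - (starRingEnd ℂ) (ρ β (k + 1)))) *
        (x / (4:ℝ) ^ (k + 1) : ℝ)) =
      Complex.exp ((1 - s) * x) * Complex.exp (x * -((4:ℂ) ^ (k + 1))⁻¹) *
        Complex.exp (-(γ β (k + 1) * x) * Complex.I) := by
    have hc : (starRingEnd ℂ) (ρ β (k + 1)) =
        1 - 1 / 4 ^ (k + 1) - Complex.I * (γ β (k + 1) : ℝ) := by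
      have h4 : (starRingEnd ℂ) 4 = 4 := Complex.conj_ofNat 4
      simp [ρ, h4, sub_eq_add_neg]
    rw [← Complex.exp_add, ← Complex.exp_add, hc]
    congr 1
    push_cast
    field_simp
    ring
  rw [h1, h2]
  push_cast
  rw [Complex.cos]
  ring

theorem re_mul_sub_rho (s : ℂ) (β : ℝ) (k : ℕ) :
    ((4:ℂ) ^ k * (s - ρ β k)).re = 4 ^ k * (s.re - 1) + 1 ∧
      ((4:ℂ) ^ k * (s - (starRingEnd ℂ) (ρ β k))).re = 4 ^ k * (s.re - 1) + 1 := by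
  have h4 : (4:ℂ) ^ k = ((4 ^ k : ℝ) : ℂ) := by push_cast; rfl
  have hρ : (ρ β k).re = 1 - 1 / 4 ^ k := by
    rw [ρ, h4, ← Complex.ofReal_one, ← Complex.ofReal_div, Complex.add_re, Complex.sub_re,
      Complex.ofReal_re, Complex.ofReal_re, Complex.re_mul_ofReal, Complex.I_re, zero_mul, add_zero]
  rw [h4, Complex.re_ofReal_mul, Complex.re_ofReal_mul, Complex.sub_re, Complex.sub_re,
    Complex.conj_re, hρ]
  have : (4:ℝ) ^ k ≠ 0 := by positivity
  constructor <;> · field_simp; ring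

theorem integral_zeroTerm {s : ℂ} (hs : 1 < s.re) (β : ℝ) (k : ℕ) :
    Integrable (zeroTerm β s k) ∧
      Complex.exp (-∫ x, zeroTerm β s k x) = G ((4:ℂ) ^ (k + 1) * (s - ρ β (k + 1))) *
            G ((4:ℂ) ^ (k + 1) * (s - (starRingEnd ℂ) (ρ β (k + 1)))) ∧
      ∫ x, ‖zeroTerm β s k x‖ ≤ 3 * Real.exp (-(4 ^ (k + 1) * (s.re - 1) + 1)) := by
  obtain ⟨hr1, hr2⟩ := re_mul_sub_rho s β (k + 1)
  have hσ : 1 ≤ (4:ℝ) ^ (k + 1) * (s.re - 1) + 1 := by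
    have : 0 ≤ (4:ℝ) ^ (k + 1) * (s.re - 1) := mul_nonneg (by positivity) (by linarith)
    linarith
  have hT : zeroTerm β s k = fun x => _ := funext (zeroTerm_eq β s k)
  set z₁ := (4:ℂ) ^ (k + 1) * (s - ρ β (k + 1))
  set z₂ := (4:ℂ) ^ (k + 1) * (s - (starRingEnd ℂ) (ρ β (k + 1)))
  have hz₁ : 0 < z₁.re := by linarith
  have hz₂ : 0 < z₂.re := by linarith
  set K : ℝ → ℂ := fun y => Complex.exp (-z₁ * y) * g (Real.exp y) +
    Complex.exp (-z₂ * y) * g (Real.exp y) with hK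
  replace hT : zeroTerm β s k = fun x => ((4:ℂ) ^ (k + 1))⁻¹ * K (x / (4:ℝ) ^ (k + 1)) := hT
  have hl : (0:ℝ) < 4 ^ (k + 1) := by positivity
  have hKint : Integrable K := (laplace_g hz₁).1.add (laplace_g hz₂).1
  refine ⟨hT ▸ (hKint.comp_div hl.ne').const_mul _, ?_, ?_⟩
  · rw [hT, integral_const_mul, Measure.integral_comp_div K, abs_of_pos hl, hK,
      integral_add (laplace_g hz₁).1 (laplace_g hz₂).1, (laplace_g hz₁).2, (laplace_g hz₂).2,
      ← exp_log_one_sub_laplaceChi hz₁, ← exp_log_one_sub_laplaceChi hz₂, ← Complex.exp_add]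
    congr 1
    rw [Complex.real_smul]
    push_cast
    field_simp
    ring
  · have h1 : ∫ x, ‖zeroTerm β s k x‖ = ∫ y, ‖K y‖ := by
      have h4 : ‖((4:ℂ) ^ (k + 1))⁻¹‖ = ((4:ℝ) ^ (k + 1))⁻¹ := by simp
      simp_rw [hT, norm_mul, h4]
      rw [integral_const_mul, Measure.integral_comp_div (fun y => ‖K y‖), abs_of_pos hl, smul_eq_mul]
      field_simp
    rw [h1]
    have h2 := integral_mono hKint.norm ((laplace_g hz₁).1.norm.add (laplace_g hz₂).1.norm)
      (fun y => norm_add_le _ _)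
    refine h2.trans ?_
    simp only [Pi.add_apply]
    rw [integral_add (laplace_g hz₁).1.norm (laplace_g hz₂).1.norm, ← hr1]
    have h3 := integral_norm_laplace_g_le (z := z₁) (by linarith)
    have h4 := integral_norm_laplace_g_le (z := z₂) (by linarith)
    rw [hr2, ← hr1] at h4
    linarith

theorem summable_integral_norm_zeroTerm {s : ℂ} (hs : 1 < s.re) (β : ℝ) :
    Summable fun k => ∫ x, ‖zeroTerm β s k x‖ := by
  refine Summable.of_nonneg_of_le (fun k => integral_nonneg fun x => norm_nonneg _)
    (fun k => (integral_zeroTerm hs β k).2.2.trans (?_ : _ ≤ 3 / (s.re - 1) * (1 / 4 : ℝ) ^ k))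
    ((summable_geometric_of_lt_one (by norm_num) (by norm_num)).mul_left _)
  have hs' : 0 < s.re - 1 := by linarith
  have h : (4:ℝ) ^ k * (s.re - 1) ≤ Real.exp (4 ^ (k + 1) * (s.re - 1) + 1) := by
    refine le_trans ?_ (Real.add_one_le_exp _)
    have : 0 ≤ (4:ℝ) ^ k * (s.re - 1) := by positivity
    rw [pow_succ]
    linarith
  rw [Real.exp_neg]
  calc 3 * (Real.exp (4 ^ (k + 1) * (s.re - 1) + 1))⁻¹ ≤ 3 * ((4:ℝ) ^ k * (s.re - 1))⁻¹ := by
        gcongr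
    _ = 3 / (s.re - 1) * (1 / 4 : ℝ) ^ k := by
        rw [one_div, inv_pow]
        field_simp

theorem integral_exp_sub_exp_div {s : ℂ} (hs : 1 < s.re) :
    IntegrableOn (fun x : ℝ => (Complex.exp ((1 - s) * x) - Complex.exp (-s * x)) / x) (Ioi 0) ∧
      Complex.exp (∫ x in Ioi (0:ℝ), (Complex.exp ((1 - s) * x) - Complex.exp (-s * x)) / x) =
        s / (s - 1) := by
  set μ := volume.restrict (Ioi (0:ℝ))
  set ν := volume.restrict (Ioc (0:ℝ) 1)
  have hae : ∀ᵐ x : ℝ ∂μ, ∫ t, Complex.exp ((t - s) * x) ∂ν =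
      (Complex.exp ((1 - s) * x) - Complex.exp (-s * x)) / x := by
    filter_upwards [ae_restrict_mem measurableSet_Ioi] with x hx
    have hx0 : (x : ℂ) ≠ 0 := by exact_mod_cast (ne_of_gt hx)
    have h1 : ∀ t : ℝ, Complex.exp ((t - s) * x) =
        Complex.exp (-s * x) * Complex.exp (x * t) := fun t => by
      rw [← Complex.exp_add]
      ring_nf
    simp_rw [h1]
    rw [integral_const_mul, ← intervalIntegral.integral_of_le zero_le_one,
      integral_exp_mul_complex hx0, mul_div_assoc', mul_sub, ← Complex.exp_add, ← Complex.exp_add]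
    push_cast
    ring_nf
  have hint : Integrable (Function.uncurry fun (x t : ℝ) => Complex.exp ((t - s) * x))
      (μ.prod ν) := by
    have hb : Integrable (fun x : ℝ => Real.exp (-(s.re - 1) * x)) μ :=
      exp_neg_integrableOn_Ioi 0 (by linarith)
    refine (hb.comp_fst ν).mono' (Continuous.aestronglyMeasurable (by fun_prop)) ?_
    rw [Measure.prod_restrict]
    filter_upwards [ae_restrict_mem (measurableSet_Ioi.prod measurableSet_Ioc)] with p hp
    have h1 : 0 < p.1 := hp.1
    have h2 : p.2 ≤ 1 := hp.2.2
    simp only [Function.uncurry, Complex.norm_exp]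
    refine Real.exp_le_exp.2 ?_
    simp only [Complex.mul_re, Complex.sub_re, Complex.ofReal_re, Complex.ofReal_im]
    nlinarith
  refine ⟨(integrable_congr hae).1 hint.integral_prod_left, ?_⟩
  rw [← integral_congr_ae hae, integral_integral_swap hint]
  have h1 : ∫ t, ∫ x, Complex.exp ((t - s) * x) ∂μ ∂ν = ∫ t in (0:ℝ)..1, 1 / (s - t) := by
    rw [intervalIntegral.integral_of_le zero_le_one]
    refine setIntegral_congr_fun measurableSet_Ioc fun t ht => ?_
    have ht1 := ht.2
    have hre : ((t : ℂ) - s).re < 0 := by simp; linarith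
    have hne : (t : ℂ) - s ≠ 0 := fun h => by simp [h] at hre
    have hne' : s - (t : ℂ) ≠ 0 := fun h => hne (by rw [← neg_sub, h, neg_zero])
    change ∫ x in Ioi (0:ℝ), Complex.exp ((t - s) * x) = _
    rw [integral_exp_mul_complex_Ioi hre]
    simp only [Complex.ofReal_zero, mul_zero, Complex.exp_zero]
    rw [← neg_sub s, neg_div_neg_eq]
  have hslit : ∀ t ∈ uIcc (0:ℝ) 1, s - t ∈ Complex.slitPlane := fun t ht => by
    rw [uIcc_of_le zero_le_one] at ht
    refine Or.inl ?_
    have := ht.2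
    simp
    linarith
  have h2 : ∫ t in (0:ℝ)..1, 1 / (s - t) = -Complex.log (s - (1:ℝ)) - -Complex.log (s - (0:ℝ)) := by
    refine intervalIntegral.integral_eq_sub_of_hasDerivAt
      (f := fun t : ℝ => -Complex.log (s - t)) (fun t ht => ?_) ?_
    · have := ((hasDerivAt_id t).ofReal_comp.const_sub s).clog_real (hslit t ht)
      refine this.neg.congr_deriv ?_
      simp only [id_eq, Complex.ofReal_one]
      ring
    · refine ContinuousOn.intervalIntegrable ?_
      refine continuousOn_const.div (by fun_prop) fun t ht => Complex.slitPlane_ne_zero (hslit t ht)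
  rw [h1, h2, show ∀ a b : ℂ, -a - -b = b - a by intros; ring, Complex.exp_sub,
    Complex.exp_log (Complex.slitPlane_ne_zero (hslit 0 (by simp))),
    Complex.exp_log (Complex.slitPlane_ne_zero (hslit 1 (by simp)))]
  simp

theorem zeroTerm_of_nonpos (β : ℝ) (s : ℂ) (k : ℕ) {x : ℝ} (hx : x ≤ 0) :
    zeroTerm β s k x = 0 := by
  rw [zeroTerm_eq, g_exp_of_lt_one]
  · simp
  · exact (div_nonpos_of_nonpos_of_nonneg hx (by positivity)).trans_lt one_pos

theorem exp_smul_cpow_mul_fC (β : ℝ) (s : ℂ) {x : ℝ} :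
    Real.exp x • ((Real.exp x : ℂ) ^ (-s) * (fC β (Real.exp x) : ℝ)) =
      (Complex.exp ((1 - s) * x) - Complex.exp (-s * x)) / x - ∑' k, zeroTerm β s k x := by
  have h1 : Complex.exp ((1 - s) * x) = (Real.exp x : ℂ) * (Real.exp x : ℂ) ^ (-s) := by
    rw [Complex.cpow_def_of_ne_zero (by exact_mod_cast (Real.exp_pos x).ne'),
      ← Complex.ofReal_log (Real.exp_pos x).le, Real.log_exp, Complex.ofReal_exp,
      ← Complex.exp_add]
    ring_nf
  have h2 : Complex.exp (-s * x) = Complex.exp ((1 - s) * x) * ((Real.exp x)⁻¹ : ℝ) := by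
    rw [← Real.exp_neg, Complex.ofReal_exp, ← Complex.exp_add]
    push_cast
    ring_nf
  simp only [zeroTerm]
  rw [tsum_mul_left, ← Complex.ofReal_tsum, tsum_mul_left, Complex.real_smul, ← mul_assoc, ← h1, h2,
    fC, Real.log_exp]
  push_cast
  ring

/-- For `Re s > 1`, `exp(∫₁^∞ v^{-s} f_C(v) dv) = (s/(s-1)) ∏_{k≥1} G(l_k(s-ρ_k)) G(l_k(s-ρ̄_k))`. -/
theorem zetaC_eq (β : ℝ) (hβ : β ∈ Set.Ioo (0:ℝ) 1) (s : ℂ) (hs : 1 < s.re) :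
    Complex.exp (∫ v in Set.Ioi (1:ℝ), (v : ℂ) ^ (-s) * (fC β v : ℝ))
      = s / (s - 1) * ∏' k : ℕ,
          G ((4:ℂ) ^ (k + 1) * (s - ρ β (k + 1))) *
            G ((4:ℂ) ^ (k + 1) * (s - (starRingEnd ℂ) (ρ β (k + 1)))) := by
  have hint (k : ℕ) := (integral_zeroTerm hs β k).1
  have hsum := summable_integral_norm_zeroTerm hs β
  have hprod := (hasSum_integral_of_summable_integral_norm hint hsum).neg.cexp
  simp only [Function.comp_def, (integral_zeroTerm hs β _).2.1] at hprod
  obtain ⟨hA, hAexp⟩ := integral_exp_sub_exp_div hs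
  rw [← Real.exp_zero, ← integral_comp_exp_Ioi]
  simp_rw [exp_smul_cpow_mul_fC]
  rw [integral_sub hA (integrable_tsum_of_summable_integral_norm hint hsum).integrableOn,
    setIntegral_eq_integral_of_forall_compl_eq_zero (f := fun x => ∑' k, zeroTerm β s k x)
      (fun x hx => by simp [zeroTerm_of_nonpos β s _ (not_lt.1 hx)]),
    sub_eq_add_neg, Complex.exp_add, hAexp, hprod.tprod_eq]
end
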